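/- Let ω₀, r, ξ be real numbers with ω₀ > 0, r > 0, r ≠ 1 and 0 < ξ < 1/√2, and set β = 2ξ² − 1 and μ = 4ξ²(ξ − 1)(ξ + 1). Then for every real root γ of M(γ) = μγ⁴ + ((r² − 1)² − 2μr²)γ² + μr⁴, there exists a real number ω such that n(ω, γ) = 0 and (∂n/∂ω)(ω, γ) = 0. -/

import Mathlib

/-- The bivariate polynomial
`n(ω, γ) = (γ² − r⁴)ω⁴ + 2r²ω₀²β(γ² − r²)ω² + r⁴ω₀⁴(γ² − 1)`. -/
def nPoly (ω₀ r β : ℝ) (ω γ : ℝ) : ℝ :=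
  (γ ^ 2 - r ^ 4) * ω ^ 4 + 2 * r ^ 2 * ω₀ ^ 2 * β * (γ ^ 2 - r ^ 2) * ω ^ 2 +
    r ^ 4 * ω₀ ^ 4 * (γ ^ 2 - 1)

theorem hasDerivAt_nPoly (ω₀ r β ω γ : ℝ) :
    HasDerivAt (fun w => nPoly ω₀ r β w γ)
      (4 * ω * ((γ ^ 2 - r ^ 4) * ω ^ 2 + r ^ 2 * ω₀ ^ 2 * β * (γ ^ 2 - r ^ 2))) ω := by
  unfold nPoly
  have h := (((hasDerivAt_pow 4 ω).const_mul (γ ^ 2 - r ^ 4)).add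
    ((hasDerivAt_pow 2 ω).const_mul (2 * r ^ 2 * ω₀ ^ 2 * β * (γ ^ 2 - r ^ 2)))).add_const
      (r ^ 4 * ω₀ ^ 4 * (γ ^ 2 - 1))
  exact h.congr_deriv (by push_cast; ring)

/-- For `0 < ξ < 1/√2`, every real root `γ` of
`M(γ) = μγ⁴ + ((r²−1)² − 2μr²)γ² + μr⁴` lifts to a real common solution `(ω, γ)`
of `n = 0` and `∂n/∂ω = 0`. -/
theorem roots_of_M_are_attained (ω₀ r ξ β μ : ℝ)
    (hω₀ : 0 < ω₀) (hr : 0 < r) (hr1 : r ≠ 1)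
    (hξ₁ : 0 < ξ) (hξ₂ : ξ < 1 / Real.sqrt 2)
    (hβ : β = 2 * ξ ^ 2 - 1) (hμ : μ = 4 * ξ ^ 2 * (ξ - 1) * (ξ + 1)) :
    ∀ γ : ℝ,
      μ * γ ^ 4 + ((r ^ 2 - 1) ^ 2 - 2 * μ * r ^ 2) * γ ^ 2 + μ * r ^ 4 = 0 →
      ∃ ω : ℝ, nPoly ω₀ r β ω γ = 0 ∧ deriv (fun w => nPoly ω₀ r β w γ) ω = 0 := by
  intro γ hM
  have hξ : ξ ^ 2 < 1 / 2 := by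
    calc ξ ^ 2 < (1 / Real.sqrt 2) ^ 2 := by gcongr
      _ = 1 / 2 := by rw [div_pow, Real.sq_sqrt (by norm_num), one_pow]
  have hβ0 : β ≤ 0 := by linarith
  have hdisc : (γ ^ 2 - r ^ 4) * (γ ^ 2 - 1) = β ^ 2 * (γ ^ 2 - r ^ 2) ^ 2 := by
    subst hβ hμ
    linear_combination -hM
  have hr2 : r ^ 2 ≠ 1 := fun h => hr1 ((pow_eq_one_iff_of_nonneg hr.le two_ne_zero).1 h)
  have hA : γ ^ 2 - r ^ 4 ≠ 0 := by
    intro hA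
    have hβD : β * (γ ^ 2 - r ^ 2) = 0 := by
      rw [hA, zero_mul, ← mul_pow] at hdisc
      exact pow_eq_zero_iff two_ne_zero |>.1 hdisc.symm
    rcases mul_eq_zero.1 hβD with h | h
    · linarith
    · exact mul_ne_zero (pow_ne_zero 2 hr.ne') (sub_ne_zero.2 hr2)
        (by linear_combination h - hA)
  have hDA : 0 ≤ (γ ^ 2 - r ^ 2) / (γ ^ 2 - r ^ 4) := by
    have h : (γ ^ 2 - r ^ 2) / (γ ^ 2 - r ^ 4) =
        ((γ ^ 2 - r ^ 4) ^ 2 + r ^ 2 * (β ^ 2 * (γ ^ 2 - r ^ 2) ^ 2)) /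
          ((1 + r ^ 2) * (γ ^ 2 - r ^ 4) ^ 2) := by
      rw [← hdisc]
      field_simp
      ring
    rw [h]
    positivity
  have hW : 0 ≤ r ^ 2 * ω₀ ^ 2 * -β * ((γ ^ 2 - r ^ 2) / (γ ^ 2 - r ^ 4)) :=
    mul_nonneg (mul_nonneg (by positivity) (by linarith)) hDA
  obtain ⟨ω, hω⟩ : ∃ ω : ℝ,
      (γ ^ 2 - r ^ 4) * ω ^ 2 + r ^ 2 * ω₀ ^ 2 * β * (γ ^ 2 - r ^ 2) = 0 := by
    refine ⟨Real.sqrt (r ^ 2 * ω₀ ^ 2 * -β * ((γ ^ 2 - r ^ 2) / (γ ^ 2 - r ^ 4))), ?_⟩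
    rw [Real.sq_sqrt hW]
    field_simp
    ring
  refine ⟨ω, mul_left_cancel₀ hA ?_, ?_⟩
  · unfold nPoly
    linear_combination
      ((γ ^ 2 - r ^ 4) * ω ^ 2 + r ^ 2 * ω₀ ^ 2 * β * (γ ^ 2 - r ^ 2)) * hω +
        r ^ 4 * ω₀ ^ 4 * hdisc
  · rw [(hasDerivAt_nPoly ω₀ r β ω γ).deriv, hω, mul_zero]
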